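/- arXiv:1107.2033 — 5 statements merged into one kernel-verified Lean document; each statement's English description precedes it below -/
import Mathlib

section
/- For every t ∈ {1,…,n}, the boosted-and-folded solution satisfies ∑_{t'=1}^{t} ∑_{e∈U} x_{e,t'} ≤ 2·Q·t. -/
open Finset
open scoped Classical

theorem card_filter_two_pow_mul_le (n : ℕ) {m : ℕ} (hm : m ≠ 0) :
    #{k ∈ Icc 1 n | ∃ i : ℕ, m = 2 ^ i * k} ≤ padicValNat 2 m + 1 := by
  have hsub : {k ∈ Icc 1 n | ∃ i : ℕ, m = 2 ^ i * k} ⊆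
      (range (padicValNat 2 m + 1)).image (fun i => m / 2 ^ i) := by
    intro k hk
    obtain ⟨i, hi⟩ := (mem_filter.1 hk).2
    refine mem_image.2 ⟨i, mem_range.2 (Nat.lt_succ_of_le ?_), ?_⟩
    · exact (padicValNat_dvd_iff_le hm).1 ⟨k, hi⟩
    · exact Nat.div_eq_of_eq_mul_right (by positivity) hi
  calc _ ≤ _ := card_le_card hsub
    _ ≤ _ := card_image_le
    _ = _ := card_range _

theorem padicValNat_two_factorial_le (t : ℕ) : padicValNat 2 t.factorial ≤ t := by
  have h := sub_one_mul_padicValNat_factorial (p := 2) t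
  omega

theorem sum_padicValNat_eq_factorial (p : ℕ) [Fact p.Prime] (t : ℕ) :
    ∑ m ∈ Icc 1 t, padicValNat p m = padicValNat p t.factorial := by
  induction t with
  | zero => simp
  | succ t ih =>
    rw [sum_Icc_succ_top (by omega), ih, Nat.factorial_succ,
      padicValNat.mul (by omega) t.factorial_ne_zero, add_comm]

theorem sum_card_filter_two_pow_mul_le (n t : ℕ) :
    ∑ m ∈ Icc 1 t, #{k ∈ Icc 1 n | ∃ i : ℕ, m = 2 ^ i * k} ≤ 2 * t := by
  calc _ ≤ ∑ m ∈ Icc 1 t, (padicValNat 2 m + 1) := sum_le_sum fun m hm =>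
        card_filter_two_pow_mul_le n (by have := (mem_Icc.1 hm).1; omega)
    _ = padicValNat 2 t.factorial + t := by
        simp [sum_add_distrib, sum_padicValNat_eq_factorial]
    _ ≤ 2 * t := by have := padicValNat_two_factorial_le t; omega

/-- Lemma 1, inequality (1): the boosted-and-folded solution `x`, defined from the LP
solution `x*` by `x_{e,t'} = Q · ∑_{t'' ∈ I(t')} x*_{e,t''}` where
`I(t') = {t'' ∈ [n] : t' = 2^i · t''}`, satisfies
`∑_{t'=1}^{t} ∑_{e∈U} x_{e,t'} ≤ 2·Q·t` for every `t ∈ [n]`. -/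
theorem sum_boosted_le {ι : Type*} (n : ℕ) (hn : 0 < n) (U : Finset ι)
    (Q : ℝ) (hQ : 0 < Q) (xstar x : ι → ℕ → ℝ)
    (hxstar_nonneg : ∀ e t, 0 ≤ xstar e t)
    (hsum : ∀ t ∈ Finset.Icc 1 n, ∑ e ∈ U, xstar e t = 1)
    (hx : ∀ e t', x e t' =
      Q * ∑ t'' ∈ (Finset.Icc 1 n).filter (fun t'' => ∃ i : ℕ, t' = 2 ^ i * t''),
        xstar e t'')
    (t : ℕ) (ht : t ∈ Finset.Icc 1 n) :
    ∑ t' ∈ Finset.Icc 1 t, ∑ e ∈ U, x e t' ≤ 2 * Q * t := by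
  have hfold : ∀ m, ∑ e ∈ U, x e m =
      Q * (#{k ∈ Icc 1 n | ∃ i : ℕ, m = 2 ^ i * k} : ℝ) := by
    intro m
    simp_rw [hx]
    rw [← mul_sum, sum_comm, sum_congr rfl fun k hk => hsum k (mem_filter.1 hk).1]
    simp
  simp_rw [hfold]
  rw [← mul_sum, mul_comm 2 Q, mul_assoc]
  refine mul_le_mul_of_nonneg_left ?_ hQ.le
  exact_mod_cast sum_card_filter_two_pow_mul_le n t
end

section
/- For every e ∈ U and every t ≤ ⌊n/2⌋, the boosted-and-folded solution satisfies ∑_{t'=t+1}^{2t} x_{e,t'} ≥ Q · ∑_{t'=1}^{t} x*_{e,t'}. -/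
open Finset
open scoped Classical

/-- Every `1 ≤ s ≤ t` has a power-of-two multiple in `(t, 2t]`, with an explicit exponent. -/
theorem two_pow_log_mul_mem_Icc {s t : ℕ} (hs : 1 ≤ s) (hst : s ≤ t) :
    2 ^ Nat.log 2 (2 * t / s) * s ∈ Finset.Icc (t + 1) (2 * t) := by
  have hne : 2 * t / s ≠ 0 := (Nat.div_pos (by lia) hs).ne'
  have hle := (Nat.le_div_iff_mul_le hs).1 (Nat.pow_log_le_self 2 hne)
  have hlt := (Nat.div_lt_iff_lt_mul hs).1 (Nat.lt_pow_succ_log_self one_lt_two (2 * t / s))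
  rw [pow_succ, mul_right_comm] at hlt
  exact Finset.mem_Icc.2 ⟨by lia, hle⟩

/-- Lemma 1, inequality (2): for every `e ∈ U` and every `t ≤ ⌊n/2⌋`, the
boosted-and-folded solution `x`, defined from `x*` by
`x_{e,t'} = Q · ∑_{t'' ∈ I(t')} x*_{e,t''}` where `I(t') = {t'' ∈ [n] : t' = 2^i · t''}`,
satisfies `∑_{t'=t+1}^{2t} x_{e,t'} ≥ Q · ∑_{t'=1}^{t} x*_{e,t'}`. -/
theorem sum_boosted_doubling_ge {ι : Type*} (n : ℕ) (hn : 0 < n) (U : Finset ι)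
    (Q : ℝ) (hQ : 0 < Q) (xstar x : ι → ℕ → ℝ)
    (hxstar_nonneg : ∀ e t, 0 ≤ xstar e t)
    (hx : ∀ e t', x e t' =
      Q * ∑ t'' ∈ (Finset.Icc 1 n).filter (fun t'' => ∃ i : ℕ, t' = 2 ^ i * t''),
        xstar e t'')
    (e : ι) (he : e ∈ U) (t : ℕ) (ht1 : 1 ≤ t) (ht2 : t ≤ n / 2) :
    Q * ∑ t' ∈ Finset.Icc 1 t, xstar e t' ≤ ∑ t' ∈ Finset.Icc (t + 1) (2 * t), x e t' := by
  simp_rw [hx, ← Finset.mul_sum]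
  refine mul_le_mul_of_nonneg_left ?_ hQ.le
  have hmaps : ∀ s ∈ Finset.Icc 1 t,
      2 ^ Nat.log 2 (2 * t / s) * s ∈ Finset.Icc (t + 1) (2 * t) := fun s hs =>
    two_pow_log_mul_mem_Icc (Finset.mem_Icc.1 hs).1 (Finset.mem_Icc.1 hs).2
  rw [← Finset.sum_fiberwise_of_maps_to hmaps]
  refine Finset.sum_le_sum fun t' _ =>
    Finset.sum_le_sum_of_subset_of_nonneg (fun s hs => ?_) fun s _ _ => hxstar_nonneg e s
  obtain ⟨hs, hst'⟩ := Finset.mem_filter.1 hs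
  rw [Finset.mem_Icc] at hs
  exact Finset.mem_filter.2 ⟨Finset.mem_Icc.2 ⟨hs.1, by lia⟩, _, hst'.symm⟩
end

section
/- The iteratively defined solution equals the closed form: f_{⌊n/2⌋}(e,t') = Q · ∑_{t'' ∈ I(t')} x*_{e,t''} for all e ∈ U and t' ∈ {1,…,n}, where I(t') = {t'' ∈ {1,…,n} : t' = 2^i · t'' for some integer i ≥ 0}. -/
open Finset
open scoped Classical

theorem filter_eq_two_pow_mul_of_odd {n s : ℕ} (hs : s ∈ Finset.Icc 1 n) (hodd : ¬ Even s) :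
    (Finset.Icc 1 n).filter (fun u => ∃ i : ℕ, s = 2 ^ i * u) = {s} := by
  ext u
  simp only [Finset.mem_filter, Finset.mem_singleton]
  constructor
  · rintro ⟨-, i, rfl⟩
    cases i with
    | zero => simp
    | succ i => exact absurd (by simp [pow_succ, parity_simps]) hodd
  · rintro rfl
    exact ⟨hs, 0, by simp⟩

theorem filter_two_mul_eq_two_pow_mul {n s : ℕ} (hs : 2 * s ∈ Finset.Icc 1 n) :
    (Finset.Icc 1 n).filter (fun u => ∃ i : ℕ, 2 * s = 2 ^ i * u) =
      insert (2 * s) ((Finset.Icc 1 n).filter (fun u => ∃ i : ℕ, s = 2 ^ i * u)) := by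
  ext u
  simp only [Finset.mem_filter, Finset.mem_insert]
  constructor
  · rintro ⟨hu, i, hi⟩
    cases i with
    | zero => left; simpa using hi.symm
    | succ i => exact Or.inr ⟨hu, i, by rw [pow_succ] at hi; linarith⟩
  · rintro (rfl | ⟨hu, i, hi⟩)
    · exact ⟨hs, 0, by simp⟩
    · exact ⟨hu, i + 1, by rw [hi]; ring⟩

theorem two_mul_notMem_filter_two_pow_mul {n s : ℕ} (hs : 0 < s) :
    2 * s ∉ (Finset.Icc 1 n).filter (fun u => ∃ i : ℕ, s = 2 ^ i * u) := by
  simp only [Finset.mem_filter, not_and, not_exists]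
  intro _ i hi
  have := Nat.le_mul_of_pos_left (2 * s) (Nat.two_pow_pos i)
  omega

/-- Folding `h s` into `h (2 * s)` successively for `s = 1, …, m` turns `h` into a function `g`
satisfying `g s = h s` for odd `s` and `g (2 * s) = h (2 * s) + g s`, on the entries reached. -/
theorem iterated_fold_eq {m n : ℕ} (hmn : 2 * m ≤ n) (F : ℕ → ℕ → ℝ) (g h : ℕ → ℝ)
    (hF0 : ∀ s, F 0 s = h s)
    (hF : ∀ t < m, ∀ s, F (t + 1) s = if s = 2 * (t + 1) then F t s + F t (t + 1) else F t s)
    (hodd : ∀ s ∈ Finset.Icc 1 n, ¬ Even s → g s = h s)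
    (heven : ∀ s, 0 < s → 2 * s ≤ n → g (2 * s) = h (2 * s) + g s) :
    ∀ t ≤ m, ∀ s ∈ Finset.Icc 1 n, F t s = if Even s ∧ s ≤ 2 * t then g s else h s := by
  intro t
  induction t with
  | zero =>
    intro _ s hs
    rw [hF0, if_neg]
    rw [Finset.mem_Icc] at hs
    omega
  | succ t ih =>
    intro ht s hs
    have ih := ih (by omega)
    rw [hF t (by omega)]
    split_ifs with hst heven_le heven_le
    · subst hst
      have hmem : t + 1 ∈ Finset.Icc 1 n := by rw [Finset.mem_Icc]; omega
      rw [heven (t + 1) (by omega) (by omega), ih _ hs, if_neg (by omega), ih _ hmem]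
      congr 1
      split_ifs with hc
      · rfl
      · refine (hodd _ hmem fun he => hc ⟨he, ?_⟩).symm
        obtain ⟨k, hk⟩ := he
        omega
    · exact absurd ⟨hst ▸ even_two_mul _, hst.le⟩ heven_le
    · rw [ih s hs, if_pos]
      obtain ⟨⟨k, hk⟩, hle⟩ := heven_le
      exact ⟨⟨k, hk⟩, by omega⟩
    · rw [ih s hs, if_neg]
      exact fun hc => heven_le ⟨hc.1, by omega⟩

/-- Equation (4) of the paper: the iteratively defined boosted-and-folded solution
(initialize `f₀ = Q·x*`; for `t = 1, …, ⌊n/2⌋` set `f_t(e,2t) = f_{t-1}(e,2t) + f_{t-1}(e,t)`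
and leave all other entries unchanged) equals the closed form
`f_{⌊n/2⌋}(e,t') = Q · ∑_{t'' ∈ I(t')} x*_{e,t''}`, where
`I(t') = {t'' ∈ [n] : t' = 2^i · t'' for some i ≥ 0}`. -/
theorem folded_closed_form {ι : Type*} (n : ℕ) (hn : 0 < n) (Q : ℝ) (hQ : 0 < Q)
    (xstar : ι → ℕ → ℝ) (f : ℕ → ι → ℕ → ℝ)
    (hf0 : ∀ e s, f 0 e s = Q * xstar e s)
    (hstep : ∀ t, 1 ≤ t → t ≤ n / 2 → ∀ e s,
      f t e s = if s = 2 * t then f (t - 1) e s + f (t - 1) e t else f (t - 1) e s)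
    (e : ι) (t' : ℕ) (ht' : t' ∈ Finset.Icc 1 n) :
    f (n / 2) e t' =
      Q * ∑ t'' ∈ (Finset.Icc 1 n).filter (fun t'' => ∃ i : ℕ, t' = 2 ^ i * t''),
        xstar e t'' := by
  have hodd : ∀ s ∈ Finset.Icc 1 n, ¬ Even s →
      Q * ∑ u ∈ (Finset.Icc 1 n).filter (fun u => ∃ i : ℕ, s = 2 ^ i * u), xstar e u =
        Q * xstar e s := by
    intro s hs ho
    rw [filter_eq_two_pow_mul_of_odd hs ho, Finset.sum_singleton]
  rw [iterated_fold_eq (Nat.mul_div_le n 2) (fun t s => f t e s)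
    (fun s => Q * ∑ u ∈ (Finset.Icc 1 n).filter (fun u => ∃ i : ℕ, s = 2 ^ i * u), xstar e u)
    (fun s => Q * xstar e s) (hf0 e) (fun t ht s => hstep (t + 1) (by omega) ht e s) hodd
    (fun s hs hsn => ?_) (n / 2) le_rfl t' ht']
  · split_ifs with hc
    · rfl
    · refine (hodd t' ht' fun he => hc ⟨he, ?_⟩).symm
      obtain ⟨k, hk⟩ := he
      rw [Finset.mem_Icc] at ht'
      omega
  · rw [filter_two_mul_eq_two_pow_mul (Finset.mem_Icc.mpr ⟨by omega, hsn⟩),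
      Finset.sum_insert (two_mul_notMem_filter_two_pow_mul hs), mul_add]
end

section
/- For every e ∈ U and every integer i ≥ 0 with 2^i · T ≤ n, the boosted-and-folded solution satisfies ∑_{t'=1}^{2^i·T} x_{e,t'} ≥ (i+1) · Q · ∑_{t'=1}^{T} x*_{e,t'}. -/
open Finset
open scoped Classical

theorem succ_le_card_filter_two_pow_mul {T t : ℕ} (ht : t ∈ Finset.Icc 1 T) (i : ℕ) :
    i + 1 ≤ #((Finset.Icc 1 (2 ^ i * T)).filter (fun t' => ∃ j : ℕ, t' = 2 ^ j * t)) := by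
  obtain ⟨ht1, htT⟩ := Finset.mem_Icc.mp ht
  have hinj : Function.Injective (fun j : ℕ => 2 ^ j * t) := fun a b hab =>
    Nat.pow_right_injective le_rfl (Nat.eq_of_mul_eq_mul_right ht1 hab)
  calc i + 1 = #((Finset.range (i + 1)).image (fun j : ℕ => 2 ^ j * t)) := by
        rw [Finset.card_image_of_injective _ hinj, Finset.card_range]
    _ ≤ _ := by
        refine Finset.card_le_card fun t' ht' => ?_
        obtain ⟨j, hj, rfl⟩ := Finset.mem_image.mp ht'
        refine Finset.mem_filter.mpr ⟨Finset.mem_Icc.mpr ⟨?_, ?_⟩, j, rfl⟩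
        · exact Nat.mul_pos (by positivity) ht1
        · exact Nat.mul_le_mul (Nat.pow_le_pow_right two_pos
            (Nat.lt_succ_iff.mp (Finset.mem_range.mp hj))) htT

/-- Each `f t` with `t ≤ T` is counted at the `i + 1` points `2 ^ j * t ≤ 2 ^ i * T`, `j ≤ i`. -/
theorem succ_mul_sum_le_sum_sum_filter_two_pow_mul {n T i : ℕ} (hTn : T ≤ n) {f : ℕ → ℝ}
    (hf : ∀ t, 0 ≤ f t) :
    ((i : ℝ) + 1) * ∑ t ∈ Finset.Icc 1 T, f t ≤
      ∑ t' ∈ Finset.Icc 1 (2 ^ i * T),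
        ∑ t ∈ (Finset.Icc 1 n).filter (fun t => ∃ j : ℕ, t' = 2 ^ j * t), f t := by
  rw [Finset.sum_comm' (t' := Finset.Icc 1 n)
    (s' := fun t => (Finset.Icc 1 (2 ^ i * T)).filter (fun t' => ∃ j : ℕ, t' = 2 ^ j * t))
    (by simp only [Finset.mem_filter]; tauto), Finset.mul_sum]
  simp only [Finset.sum_const, nsmul_eq_mul]
  refine (Finset.sum_le_sum fun t ht => ?_).trans (Finset.sum_le_sum_of_subset_of_nonneg
    (Finset.Icc_subset_Icc_right hTn) fun t _ _ => mul_nonneg (Nat.cast_nonneg _) (hf t))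
  exact mul_le_mul_of_nonneg_right (mod_cast succ_le_card_filter_two_pow_mul ht i) (hf t)

/-- The inductive claim in the proof of Lemma 2: for every `e ∈ U` and every
integer `i ≥ 0` with `2^i · T ≤ n`, the boosted-and-folded solution `x`, defined from
`x*` by `x_{e,t'} = Q · ∑_{t'' ∈ I(t')} x*_{e,t''}` where
`I(t') = {t'' ∈ [n] : t' = 2^i · t''}`, satisfies
`∑_{t'=1}^{2^i·T} x_{e,t'} ≥ (i+1) · Q · ∑_{t'=1}^{T} x*_{e,t'}`. -/
theorem sum_boosted_geometric_ge {ι : Type*} (n T : ℕ) (hn : 0 < n) (hT : 0 < T)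
    (U : Finset ι) (Q : ℝ) (hQ : 0 < Q) (xstar x : ι → ℕ → ℝ)
    (hxstar_nonneg : ∀ e t, 0 ≤ xstar e t)
    (hx : ∀ e t', x e t' =
      Q * ∑ t'' ∈ (Finset.Icc 1 n).filter (fun t'' => ∃ i : ℕ, t' = 2 ^ i * t''),
        xstar e t'')
    (e : ι) (he : e ∈ U) (i : ℕ) (hi : 2 ^ i * T ≤ n) :
    ((i : ℝ) + 1) * Q * ∑ t' ∈ Finset.Icc 1 T, xstar e t'
      ≤ ∑ t' ∈ Finset.Icc 1 (2 ^ i * T), x e t' := by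
  have hTn : T ≤ n := (Nat.le_mul_of_pos_left T (by positivity)).trans hi
  simp only [hx, ← Finset.mul_sum]
  rw [mul_comm _ Q, mul_assoc]
  exact mul_le_mul_of_nonneg_left
    (succ_mul_sum_le_sum_sum_filter_two_pow_mul hTn (hxstar_nonneg e)) hQ.le
end

section
/- Let U be a finite set, key : U → ℕ, S ⊆ U, K a positive integer with K ≤ |S|, and t₀ ∈ ℕ such that |{e ∈ S : key(e) ≤ t₀}| ≥ K. Let σ : {1,…,|U|} → U be any bijection such that key(σ(1)) ≤ key(σ(2)) ≤ … ≤ key(σ(|U|)). Then the least m with |{j ∈ {1,…,m} : σ(j) ∈ S}| ≥ K satisfies m ≤ |{e ∈ U∖S : key(e) ≤ t₀}| + K. -/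
open Finset

/-- The bound `C_S ≤ |{e ∈ U∖S : key(e) ≤ t₀}| + K` from the proof of Lemma 3: if the
elements of `U` are sequenced in order of nondecreasing `key` (ties broken arbitrarily)
via a bijection `σ : {1,…,|U|} → U`, and at least `K` elements of `S ⊆ U` have key at
most `t₀`, then the least position `m` by which `K` elements of `S` have appeared
satisfies `m ≤ |{e ∈ U∖S : key(e) ≤ t₀}| + K`. -/
theorem kth_position_le {ι : Type*} [DecidableEq ι] (U : Finset ι) (key : ι → ℕ)
    (S : Finset ι) (hSU : S ⊆ U) (K : ℕ) (hK1 : 1 ≤ K) (hK2 : K ≤ S.card)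
    (t₀ : ℕ) (ht₀ : K ≤ (S.filter (fun e => key e ≤ t₀)).card)
    (σ : ℕ → ι) (hbij : Set.BijOn σ (Set.Icc 1 U.card) ↑U)
    (hsorted : ∀ j j', 1 ≤ j → j ≤ j' → j' ≤ U.card → key (σ j) ≤ key (σ j')) :
    sInf {m : ℕ | K ≤ ((Finset.Icc 1 m).filter (fun j => σ j ∈ S)).card}
      ≤ ((U \ S).filter (fun e => key e ≤ t₀)).card + K := by
  refine Nat.sInf_le ?_
  set B := ((U \ S).filter (fun e => key e ≤ t₀)).card + K
  have hBU : B ≤ U.card := by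
    have h₁ := Finset.card_filter_le (U \ S) (fun e => key e ≤ t₀)
    have h₂ := Finset.card_sdiff_add_card_eq_card hSU
    omega
  change K ≤ ((Finset.Icc 1 B).filter (fun j => σ j ∈ S)).card
  by_contra! hlt
  have hsplit := Finset.card_filter_add_card_filter_not (s := Finset.Icc 1 B) (fun j => σ j ∈ S)
  rw [Nat.card_Icc] at hsplit
  obtain ⟨j, hj1, hjB, hjkey⟩ : ∃ j, 1 ≤ j ∧ j ≤ B ∧ t₀ < key (σ j) := by
    by_contra! hle
    have hcard : ((Finset.Icc 1 B).filter (fun j => ¬ σ j ∈ S)).card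
        ≤ ((U \ S).filter (fun e => key e ≤ t₀)).card := by
      refine Finset.card_le_card_of_injOn σ ?_ (hbij.injOn.mono ?_)
      · intro j hj
        simp only [coe_filter, Finset.mem_Icc, Set.mem_ofPred_eq] at hj
        have hjU : σ j ∈ U := hbij.mapsTo ⟨hj.1.1, hj.1.2.trans hBU⟩
        simpa [hjU, hj.2] using hle j hj.1.1 hj.1.2
      · intro j hj
        simp only [coe_filter, Finset.mem_Icc, Set.mem_ofPred_eq] at hj
        exact ⟨hj.1.1, hj.1.2.trans hBU⟩
    omega
  have hsub : S.filter (fun e => key e ≤ t₀)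
      ⊆ ((Finset.Icc 1 B).filter (fun j => σ j ∈ S)).image σ := by
    intro e he
    obtain ⟨heS, hekey⟩ := Finset.mem_filter.mp he
    obtain ⟨i, hi, rfl⟩ := hbij.surjOn (hSU heS)
    have hij : i < j := by
      by_contra! hji
      have := hsorted j i hj1 hji hi.2
      omega
    exact Finset.mem_image_of_mem σ
      (Finset.mem_filter.mpr ⟨Finset.mem_Icc.mpr ⟨hi.1, by omega⟩, heS⟩)
  have := (Finset.card_le_card hsub).trans Finset.card_image_le
  omega
end
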